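/- Fix any integer k ≥ 2, any α > 2/e, and any β ≥ 0. Then for all sufficiently large T ∈ ℕ, there does not exist a truthful k-bidder mechanism over T rounds that satisfies Rev(v) ≥ α·RevSTB(v) − β for all type profiles v. -/

import Mathlib

open Finset

/-- A `k`-bidder type profile over `T` rounds (1-indexed): values in `[0,1]`. -/
def IsProfileK (k T : ℕ) (v : Fin k → ℕ → ℝ) : Prop :=
  ∀ i, ∀ t ∈ Finset.Icc 1 T, v i t ∈ Set.Icc (0:ℝ) 1

/-- Total value of bidder `i`. -/
def TotVal (T : ℕ) {k : ℕ} (v : Fin k → ℕ → ℝ) (i : Fin k) : ℝ :=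
  ∑ t ∈ Finset.Icc 1 T, v i t

/-- The sell-the-business benchmark for `k` bidders: the second largest total
value, expressed as the largest value of `min(|v_i|, |v_j|)` over pairs `i ≠ j`. -/
noncomputable def RevSTBK (k T : ℕ) (v : Fin k → ℕ → ℝ) : ℝ :=
  sSup {y : ℝ | ∃ i j : Fin k, i ≠ j ∧ y = min (TotVal T v i) (TotVal T v j)}

/-- Revenue of a `k`-bidder mechanism: total payments minus reimbursements. -/
def RevK (k T : ℕ) (x : (Fin k → ℕ → ℝ) → Fin k → ℕ → ℝ)
    (g : (Fin k → ℕ → ℝ) → Fin k → ℝ) (v : Fin k → ℕ → ℝ) : ℝ :=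
  (∑ i, ∑ t ∈ Finset.Icc 1 T, x v i t) - ∑ i, g v i

/-- A truthful `k`-bidder mechanism: feasible allocations, nonnegative payments
and reimbursements, limited liability, and dynamic incentive compatibility. -/
def TruthfulK (k T : ℕ) (r x : (Fin k → ℕ → ℝ) → Fin k → ℕ → ℝ)
    (g : (Fin k → ℕ → ℝ) → Fin k → ℝ) : Prop :=
  (∀ v, IsProfileK k T v →
    (∀ i, 0 ≤ g v i) ∧
    ∀ t ∈ Finset.Icc 1 T,
      (∀ i, r v i t ∈ Set.Icc (0:ℝ) 1 ∧ 0 ≤ x v i t ∧ x v i t ≤ r v i t * v i t) ∧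
      (∑ i, r v i t) ≤ 1) ∧
  (∀ v, IsProfileK k T v → ∀ i, ∀ w : ℕ → ℝ,
    IsProfileK k T (Function.update v i w) →
    ∀ τ ∈ Finset.Icc 1 T,
      (∀ t ∈ Finset.Icc 1 τ,
        x (Function.update v i w) i t ≤ r (Function.update v i w) i t * v i t) →
      (∑ t ∈ Finset.Icc 1 T, (r v i t * v i t - x v i t)) + g v i ≥
        (∑ t ∈ Finset.Icc 1 τ,
          (r (Function.update v i w) i t * v i t - x (Function.update v i w) i t)) +
          x (Function.update v i w) i τ)

/-- `w` takes values in `[0,1]` during the rounds `0, …, T - 1`. -/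
def IsValuation (T : ℕ) (w : ℕ → ℝ) : Prop := ∀ t < T, w t ∈ Set.Icc (0 : ℝ) 1

/-- A valuation that is nondecreasing with values in `[lo, hi]` before round `n`, zero from
round `n` on, and of total value in `[L, L + 1]`. -/
structure IsRamp (L lo hi : ℝ) (n : ℕ) (w : ℕ → ℝ) : Prop where
  mono : ∀ s t, s ≤ t → t < n → w s ≤ w t
  lower : ∀ t < n, lo ≤ w t
  upper : ∀ t < n, w t ≤ hi
  zero : ∀ t, n ≤ t → w t = 0
  le_total : L ≤ ∑ s ∈ range n, w s
  total_le : ∑ s ∈ range n, w s ≤ L + 1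

/-- The allocation rule `R` and the utility `U` that a truthful mechanism induces for a single
bidder when the types of the other bidders are fixed. -/
structure IsScreening (T : ℕ) (L B : ℝ) (R : (ℕ → ℝ) → ℕ → ℝ) (U : (ℕ → ℝ) → ℝ) : Prop where
  alloc_mem : ∀ w, IsValuation T w → ∀ t < T, R w t ∈ Set.Icc (0 : ℝ) 1
  utility_nonneg : ∀ w, IsValuation T w → 0 ≤ U w
  utility_le : ∀ w, IsValuation T w → L ≤ ∑ t ∈ range T, w t → ∑ t ∈ range T, w t ≤ L + 1 →
    U w ≤ B
  incentive : ∀ v w, IsValuation T v → IsValuation T w → ∀ τ ≤ T, (∀ t < τ, w t ≤ v t) →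
    ∑ t ∈ range τ, R w t * (v t - w t) ≤ U v

namespace IsRamp

variable {L lo hi : ℝ} {n : ℕ} {w : ℕ → ℝ}

lemma nonneg (hw : IsRamp L lo hi n w) (hlo : 0 ≤ lo) (t : ℕ) : 0 ≤ w t := by
  rcases lt_or_ge t n with h | h
  · exact hlo.trans (hw.lower t h)
  · exact (hw.zero t h).ge

lemma le_upper (hw : IsRamp L lo hi n w) (hhi : 0 ≤ hi) (t : ℕ) : w t ≤ hi := by
  rcases lt_or_ge t n with h | h
  · exact hw.upper t h
  · exact (hw.zero t h).le.trans hhi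

lemma isValuation (hw : IsRamp L lo hi n w) (hlo : 0 ≤ lo) (hhi : 0 ≤ hi) (hhi1 : hi ≤ 1)
    (T : ℕ) : IsValuation T w :=
  fun t _ => ⟨hw.nonneg hlo t, (hw.le_upper hhi t).trans hhi1⟩

lemma length_le (hw : IsRamp L lo hi n w) (hlo : 0 < lo) {T : ℕ} (hT : L + 1 ≤ lo * T) :
    n ≤ T := by
  have h1 : (n : ℝ) * lo ≤ ∑ s ∈ range n, w s := by
    have := Finset.card_nsmul_le_sum (range n) w lo (fun s hs => hw.lower s (mem_range.1 hs))
    simpa using this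
  have h2 : lo * (n : ℝ) ≤ lo * T := by linarith [hw.total_le]
  exact_mod_cast le_of_mul_le_mul_left h2 hlo

lemma sum_range_eq (hw : IsRamp L lo hi n w) {T : ℕ} (hT : n ≤ T) :
    ∑ s ∈ range T, w s = ∑ s ∈ range n, w s := by
  symm
  apply Finset.sum_subset (range_mono hT)
  intro s _ hs
  exact hw.zero s (by simpa using hs)

lemma monotone_sum (hw : IsRamp L lo hi n w) (hlo : 0 ≤ lo) :
    Monotone fun t => ∑ s ∈ range t, w s := fun _ _ h =>
  Finset.sum_le_sum_of_subset_of_nonneg (range_mono h) fun s _ _ => hw.nonneg hlo s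

lemma lt_length (hw : IsRamp L lo hi n w) (hlo : 0 ≤ lo) {t : ℕ}
    (ht : ∑ s ∈ range t, w s < L) : t < n := by
  by_contra! h
  have := hw.monotone_sum hlo h
  linarith [hw.le_total]

end IsRamp

/-- Follow `w` before round `t`, then have value `h` for `l` rounds. -/
def jump (w : ℕ → ℝ) (h : ℝ) (t l : ℕ) : ℕ → ℝ :=
  fun s => if s < t then w s else if s < t + l then h else 0

lemma sum_jump (w : ℕ → ℝ) (h : ℝ) (t l : ℕ) :
    ∑ s ∈ range (t + l), jump w h t l s = ∑ s ∈ range t, w s + l * h := by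
  rw [Finset.sum_range_add]
  congr 1
  · refine Finset.sum_congr rfl fun s hs => ?_
    simp [jump, mem_range.1 hs]
  · rw [Finset.sum_congr rfl (g := fun _ => h)]
    · simp
    · intro s hs
      simp [jump, mem_range.1 hs]

/-- The number of rounds of value `h` needed after round `t` to bring the total up to `L`. -/
noncomputable def remaining (L h : ℝ) (w : ℕ → ℝ) (t : ℕ) : ℕ :=
  ⌈(L - ∑ s ∈ range t, w s) / h⌉₊

lemma IsRamp.jump_remaining {L lo hi h : ℝ} {n : ℕ} {w : ℕ → ℝ} (hw : IsRamp L lo hi n w)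
    (hlo : 0 < lo) (hlh : lo ≤ h) (hhh : hi ≤ h) (h1 : h ≤ 1) {t : ℕ} (ht : ∑ s ∈ range t, w s < L) :
    IsRamp L lo h (t + remaining L h w t) (jump w h t (remaining L h w t)) := by
  have htn := hw.lt_length hlo.le ht
  have hh : 0 < h := hlo.trans_le hlh
  have hdiv : 0 ≤ (L - ∑ s ∈ range t, w s) / h := div_nonneg (by linarith) hh.le
  refine ⟨?_, ?_, ?_, ?_, ?_, ?_⟩
  · intro a b hab hb
    by_cases hbt : b < t
    · simpa [jump, hbt, hab.trans_lt hbt] using hw.mono a b hab (hbt.trans htn)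
    · by_cases hat : a < t
      · simpa [jump, hbt, hb, hat] using (hw.upper a (hat.trans htn)).trans hhh
      · simp [jump, hbt, hb, hat, hab.trans_lt hb]
  · intro s hs
    by_cases hst : s < t
    · simpa [jump, hst] using hw.lower s (hst.trans htn)
    · simpa [jump, hst, hs] using hlh
  · intro s hs
    by_cases hst : s < t
    · simpa [jump, hst] using (hw.upper s (hst.trans htn)).trans hhh
    · simp [jump, hst, hs]
  · intro s hs
    have : ¬ s < t := by omega
    simp [jump, this, not_lt.2 hs]
  · rw [sum_jump]
    have := (div_le_iff₀ hh).1 (Nat.le_ceil ((L - ∑ s ∈ range t, w s) / h))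
    unfold remaining
    linarith
  · rw [sum_jump]
    have := mul_lt_mul_of_pos_right (Nat.ceil_lt_add_one hdiv) hh
    rw [add_mul, div_mul_cancel₀ _ hh.ne'] at this
    unfold remaining
    linarith

lemma IsScreening.alloc_window_le {T : ℕ} {L B : ℝ} {R : (ℕ → ℝ) → ℕ → ℝ} {U : (ℕ → ℝ) → ℝ}
    (hS : IsScreening T L B R U) {w : ℕ → ℝ} {hi h : ℝ} {t l : ℕ} (hw : IsValuation T w)
    (hj : IsValuation T (jump w h t l)) (hwhi : ∀ s, w s ≤ hi) (hh : hi ≤ h) (hT : t + l ≤ T) :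
    (h - hi) * ∑ s ∈ range l, R w (t + s) ≤ U (jump w h t l) := by
  refine le_trans ?_ (hS.incentive _ w hj hw (t + l) hT ?_)
  · rw [Finset.sum_range_add, Finset.mul_sum]
    have h0 : ∑ s ∈ range t, R w s * (jump w h t l s - w s) = 0 := by
      refine Finset.sum_eq_zero fun s hs => ?_
      simp [jump, mem_range.1 hs]
    rw [h0, zero_add]
    refine Finset.sum_le_sum fun s hs => ?_
    have hs' := mem_range.1 hs
    have : jump w h t l (t + s) = h := by simp [jump, hs']
    rw [this, mul_comm]
    exact mul_le_mul_of_nonneg_left (by linarith [hwhi (t + s)])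
      (hS.alloc_mem w hw (t + s) (by omega)).1
  · intro s hs
    by_cases hst : s < t
    · simp [jump, hst]
    · simpa [jump, hst, hs] using (hwhi s).trans hh

/-- The successive rounds at which windows of length `remaining L h w` start. -/
noncomputable def grid (L h : ℝ) (w : ℕ → ℝ) : ℕ → ℕ
  | 0 => 0
  | i + 1 => grid L h w i + remaining L h w (grid L h w i)

/-- The total value of `w` before the `i`-th point of the grid. -/
noncomputable def progress (L h : ℝ) (w : ℕ → ℝ) (i : ℕ) : ℝ :=
  ∑ s ∈ range (grid L h w i), w s

section Grid

variable {L lo hi h : ℝ} {n : ℕ} {w : ℕ → ℝ}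

lemma grid_mono : Monotone (grid L h w) :=
  monotone_nat_of_le_succ fun _ => Nat.le_add_right _ _

lemma progress_zero : progress L h w 0 = 0 := by simp [progress, grid]

lemma progress_mono (hw : IsRamp L lo hi n w) (hlo : 0 ≤ lo) : Monotone (progress L h w) :=
  (hw.monotone_sum hlo).comp grid_mono

lemma progress_succ (i : ℕ) : progress L h w (i + 1) =
    progress L h w i + ∑ s ∈ range (remaining L h w (grid L h w i)), w (grid L h w i + s) := by
  rw [progress, grid, Finset.sum_range_add, progress]

lemma progress_succ_le (hw : IsRamp L lo hi n w) (hlo : 0 ≤ lo) (hh : 0 < h) (hhi : 0 ≤ hi)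
    {i : ℕ} (hi' : progress L h w i ≤ L) :
    progress L h w (i + 1) ≤ progress L h w i + (L / h + 1) * hi := by
  rw [progress_succ]
  have h0 : 0 ≤ progress L h w i := Finset.sum_nonneg fun s _ => hw.nonneg hlo s
  have h1 := Finset.sum_le_card_nsmul (range (remaining L h w (grid L h w i)))
    (fun s => w (grid L h w i + s)) hi fun s _ => hw.le_upper hhi _
  have h2 : (remaining L h w (grid L h w i) : ℝ) ≤ L / h + 1 := by
    have h3 : 0 ≤ (L - progress L h w i) / h := div_nonneg (by linarith) hh.le
    have h4 : (L - progress L h w i) / h ≤ L / h := by gcongr; linarith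
    exact ((Nat.ceil_lt_add_one h3).trans_le (by linarith)).le
  simp only [card_range, nsmul_eq_mul] at h1
  nlinarith [mul_le_mul_of_nonneg_right h2 hhi]

lemma exists_lt_progress (hw : IsRamp L lo hi n w) (hlo : 0 ≤ lo) (hh : 0 < h) {c : ℝ}
    (hc : c < L) : ∃ i, c < progress L h w i := by
  by_contra! hcon
  have hgrid : ∀ i, i ≤ grid L h w i := by
    intro i
    induction i with
    | zero => simp
    | succ i ih =>
      have : 0 < remaining L h w (grid L h w i) :=
        Nat.ceil_pos.2 (div_pos (by have := hcon i; unfold progress at this; linarith) hh)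
      rw [grid]
      omega
  have h1 : ∑ s ∈ range n, w s ≤ progress L h w n := hw.monotone_sum hlo (hgrid n)
  linarith [hcon n, hw.le_total]

lemma value_grid_le (hw : IsRamp L lo hi n w) (hlo : 0 ≤ lo) (hh : 0 < h) {i : ℕ}
    (hi' : progress L h w (i + 1) < L) :
    w (grid L h w i) ≤
      h * (Real.log (L - progress L h w i) - Real.log (L - progress L h w (i + 1))) := by
  have hmono := progress_mono (h := h) hw hlo (Nat.le_succ i)
  have hpos : 0 < L - progress L h w i := by simp only [Nat.succ_eq_add_one] at hmono; linarith
  have hpos' : 0 < L - progress L h w (i + 1) := by linarith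
  have hn := hw.lt_length hlo hi'
  have h1 : remaining L h w (grid L h w i) * w (grid L h w i) ≤
      progress L h w (i + 1) - progress L h w i := by
    rw [progress_succ, add_sub_cancel_left]
    have := Finset.card_nsmul_le_sum (range (remaining L h w (grid L h w i)))
      (fun s => w (grid L h w i + s)) (w (grid L h w i)) fun s hs => by
        refine hw.mono _ _ (Nat.le_add_right _ _) (lt_trans ?_ hn)
        rw [grid]
        have := mem_range.1 hs
        omega
    simpa using this
  have h2 : (L - progress L h w i) / h ≤ remaining L h w (grid L h w i) := Nat.le_ceil _
  have h3 := (mul_le_mul_of_nonneg_right h2 (hw.nonneg hlo (grid L h w i))).trans h1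
  have h4 := Real.log_le_sub_one_of_pos (div_pos hpos' hpos)
  rw [Real.log_div hpos'.ne' hpos.ne'] at h4
  have h5 : w (grid L h w i) ≤
      h * ((progress L h w (i + 1) - progress L h w i) / (L - progress L h w i)) := by
    rw [← mul_div_assoc, le_div_iff₀ hpos]
    rw [div_mul_eq_mul_div, div_le_iff₀ hh] at h3
    linarith
  refine h5.trans (mul_le_mul_of_nonneg_left ?_ hh.le)
  have h6 : (L - progress L h w (i + 1)) / (L - progress L h w i) =
      1 - (progress L h w (i + 1) - progress L h w i) / (L - progress L h w i) := by
    field_simp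
    ring
  linarith

end Grid

/-- The loss per level of the ladder of ramps, on top of `L / e`. -/
noncomputable def stepLoss (L M B : ℝ) : ℝ := 3 + 2 * L / M + B / (M - 1)

lemma sum_range_grid {L h : ℝ} {w : ℕ → ℝ} (f : ℕ → ℝ) (I : ℕ) :
    ∑ s ∈ range (grid L h w I), f s =
      ∑ i ∈ range I, ∑ s ∈ range (remaining L h w (grid L h w i)), f (grid L h w i + s) := by
  induction I with
  | zero => simp [grid]
  | succ I ih => rw [Finset.sum_range_succ, grid, Finset.sum_range_add, ih]

/-- Every ramp can be randomly continued by a steeper ramp so that any screening mechanism earns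
from it at most about `L / e` plus the expected utility of the continuation, minus its own. -/
lemma IsRamp.exists_randomized_jump {L lo hi M B : ℝ} {n T : ℕ} {w : ℕ → ℝ}
    (hw : IsRamp L lo hi n w) (hL : 0 < L) (hlo : 0 < lo) (hlh : lo ≤ hi) (hM : 1 < M)
    (hMhi : M * hi ≤ 1) (hT : L + 1 ≤ lo * T) :
    ∃ (m : ℕ) (q : ℕ → ℝ) (v : ℕ → ℕ → ℝ), (∀ i < m, 0 ≤ q i) ∧ ∑ i ∈ range m, q i = 1 ∧
      (∀ i < m, ∃ n', IsRamp L lo (M * hi) n' (v i)) ∧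
      ∀ R U, IsScreening T L B R U →
        ∑ t ∈ range T, R w t * w t - U w ≤
          ∑ i ∈ range m, q i * U (v i) - U w + (L / Real.exp 1 + stepLoss L M B) := by
  set h := M * hi with hh_def
  have hhi : 0 < hi := hlo.trans_le hlh
  have hhih : hi < h := by nlinarith
  have hh : 0 < h := hhi.trans hhih
  have he : 0 < Real.exp (-1) := Real.exp_pos _
  have hexp : L / Real.exp 1 = L * Real.exp (-1) := by rw [Real.exp_neg]; rfl
  set c := (1 - Real.exp (-1)) * L with hc_def
  have hcL : c < L := by nlinarith
  have hc0 : 0 ≤ c := by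
    have : Real.exp (-1) ≤ 1 := Real.exp_le_one_iff.2 (by norm_num)
    exact mul_nonneg (by linarith) hL.le
  set p := progress L h w with hp_def
  have hpmono : Monotone p := progress_mono hw hlo.le
  obtain ⟨J, hJ, hJc⟩ : ∃ J, p J ≤ c ∧ c < p (J + 1) := by
    classical
    have hex := exists_lt_progress hw hlo.le hh hcL
    have h0 : Nat.find hex ≠ 0 := by
      intro h0
      have := Nat.find_spec hex
      rw [h0, progress_zero] at this
      linarith
    obtain ⟨J, hJ⟩ := Nat.exists_eq_succ_of_ne_zero h0
    refine ⟨J, not_lt.1 (Nat.find_min hex (by omega)), ?_⟩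
    have := Nat.find_spec hex
    rwa [hJ] at this
  have hple : ∀ i ≤ J, p i ≤ c := fun i hi => (hpmono hi).trans hJ
  have hplt : ∀ i ≤ J, p i < L := fun i hi => (hple i hi).trans_lt hcL
  have hstep : ∀ i ≤ J, p (i + 1) ≤ p i + (L / M + 1) := by
    intro i hiJ
    refine (progress_succ_le hw hlo.le hh hhi.le (hplt i hiJ).le).trans ?_
    have h1 : L / h * hi = L / M := by rw [hh_def]; field_simp
    have h2 : hi ≤ 1 := by linarith
    rw [add_mul, h1]
    linarith
  have hJ1 : c - 2 * (L / M + 1) ≤ p (J - 1) := by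
    have h0 : 0 ≤ L / M + 1 := by positivity
    rcases Nat.eq_zero_or_pos J with h | h
    · subst h
      linarith [hstep 0 le_rfl]
    · have h1 := hstep J le_rfl
      have h2 := hstep (J - 1) (by omega)
      rw [Nat.sub_add_cancel h] at h2
      linarith
  set I := J - 1 with hI
  set v : ℕ → ℕ → ℝ := fun i => jump w h (grid L h w i) (remaining L h w (grid L h w i)) with hv
  have hvramp : ∀ i ≤ J, IsRamp L lo h (grid L h w i + remaining L h w (grid L h w i)) (v i) :=
    fun i hi => hw.jump_remaining hlo (hlh.trans hhih.le) hhih.le hMhi (hplt i hi)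
  have hvval : ∀ i ≤ J, IsValuation T (v i) :=
    fun i hi => (hvramp i hi).isValuation hlo.le hh.le hMhi T
  have hwval : IsValuation T w := hw.isValuation hlo.le hhi.le (by linarith) T
  -- `a i` is the weight that the allocation of `w` in the `i`-th window calls for
  set a : ℕ → ℝ := fun i => Real.log (L - p (i + 1)) - Real.log (L - p (i + 2)) with ha
  have ha0 : ∀ i < I, 0 ≤ a i := by
    intro i hi
    have h1 := hplt (i + 2) (by omega)
    exact sub_nonneg.2 (Real.log_le_log (by linarith)
      (by linarith [hpmono (show i + 1 ≤ i + 2 by omega)]))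
  have hasum : ∑ i ∈ range I, a i ≤ 1 := by
    have h1 := Finset.sum_range_sub' (fun i => Real.log (L - p (i + 1))) I
    simp only [ha]
    rw [h1]
    rcases Nat.eq_zero_or_pos I with h | h
    · rw [h]; simp
    · have h2 := hple (I + 1) (by omega)
      have h3 : Real.log (L - p (0 + 1)) ≤ Real.log L := by
        refine Real.log_le_log (by linarith [hplt (0 + 1) (by omega)]) ?_
        have : p 0 = 0 := progress_zero
        linarith [hpmono (Nat.zero_le (0 + 1))]
      have h4 : Real.log (L * Real.exp (-1)) ≤ Real.log (L - p (I + 1)) := by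
        refine Real.log_le_log (by positivity) ?_
        rw [hc_def] at h2
        linarith
      rw [Real.log_mul hL.ne' he.ne', Real.log_exp] at h4
      linarith
  set d := 1 - ∑ i ∈ range I, a i with hd
  refine ⟨I + 1, fun i => (if i < I then a i else 0) + (if i = I then d else 0), v, ?_, ?_, ?_, ?_⟩
  · intro i _
    have h1 : 0 ≤ d := by linarith
    by_cases hi : i < I
    · simp [hi, hi.ne, ha0 i hi]
    · by_cases hi' : i = I <;> simp [hi, hi', h1]
  · rw [Finset.sum_range_succ, Finset.sum_congr rfl (g := a)]
    · simp [hd]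
    · intro i hi
      have := mem_range.1 hi
      simp [this, this.ne]
  · exact fun i hi => ⟨_, hvramp i (by omega)⟩
  · intro R U hS
    have hUI := hS.utility_nonneg _ (hvval I (by omega))
    have hsum : ∑ i ∈ range (I + 1),
        ((if i < I then a i else 0) + (if i = I then d else 0)) * U (v i) =
          ∑ i ∈ range I, a i * U (v i) + d * U (v I) := by
      rw [Finset.sum_range_succ, Finset.sum_congr rfl (g := fun i => a i * U (v i))]
      · simp
      · intro i hi
        have := mem_range.1 hi
        simp [this, this.ne]
    rw [hsum]
    have hB : ∀ i ≤ J, U (v i) ≤ B := by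
      intro i hi
      have hr := hvramp i hi
      have hs := hr.sum_range_eq (hr.length_le hlo hT)
      exact hS.utility_le _ (hvval i hi) (hs ▸ hr.le_total) (hs ▸ hr.total_le)
    have hgT : ∀ i ≤ J, grid L h w (i + 1) ≤ T := fun i hi => (hvramp i hi).length_le hlo hT
    have hgIT : grid L h w I ≤ T := (grid_mono (Nat.le_succ I)).trans (hgT I (by omega))
    have hwin : ∀ i < I, ∑ s ∈ range (remaining L h w (grid L h w i)),
        R w (grid L h w i + s) * w (grid L h w i + s) ≤ M / (M - 1) * (a i * U (v i)) := by
      intro i hiI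
      have h1 := hS.alloc_window_le (h := h) (t := grid L h w i)
        (l := remaining L h w (grid L h w i)) hwval (hvval i (by omega))
        (hw.le_upper hhi.le) hhih.le (hgT i (by omega))
      have hlt : p (i + 2) < L := hplt (i + 2) (by omega)
      have h2 : w (grid L h w (i + 1)) ≤ h * a i := value_grid_le hw hlo.le hh hlt
      have hn : grid L h w (i + 1) < n := hw.lt_length hlo.le (hplt (i + 1) (by omega))
      have h3 : ∑ s ∈ range (remaining L h w (grid L h w i)),
          R w (grid L h w i + s) * w (grid L h w i + s) ≤
          h * a i * ∑ s ∈ range (remaining L h w (grid L h w i)), R w (grid L h w i + s) := by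
        rw [Finset.mul_sum]
        refine Finset.sum_le_sum fun s hs => ?_
        have hs' : grid L h w i + s ≤ grid L h w (i + 1) := by
          have := mem_range.1 hs
          rw [grid]
          omega
        have hsT : grid L h w i + s < T := by
          have := mem_range.1 hs
          have := hgT i (by omega)
          rw [grid] at this
          omega
        rw [mul_comm]
        exact mul_le_mul_of_nonneg_right ((hw.mono _ _ hs' hn).trans h2)
          (hS.alloc_mem w hwval _ hsT).1
      have h4 : h * a i * ∑ s ∈ range (remaining L h w (grid L h w i)), R w (grid L h w i + s) =
          M / (M - 1) * (a i * ((h - hi) *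
            ∑ s ∈ range (remaining L h w (grid L h w i)), R w (grid L h w i + s))) := by
        have : M - 1 ≠ 0 := by linarith
        rw [hh_def]
        field_simp
      rw [h4] at h3
      refine h3.trans (mul_le_mul_of_nonneg_left (mul_le_mul_of_nonneg_left h1 (ha0 i hiI)) ?_)
      exact div_nonneg (by linarith) (by linarith)
    have hhead : ∑ s ∈ range (grid L h w I), R w s * w s ≤
        ∑ i ∈ range I, a i * U (v i) + B / (M - 1) := by
      rw [sum_range_grid]
      refine (Finset.sum_le_sum fun i hi => hwin i (mem_range.1 hi)).trans ?_
      rw [← Finset.mul_sum]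
      have h1 : ∑ i ∈ range I, a i * U (v i) ≤ B := by
        calc ∑ i ∈ range I, a i * U (v i) ≤ ∑ i ∈ range I, a i * B :=
              Finset.sum_le_sum fun i hi => mul_le_mul_of_nonneg_left
                (hB i (by have := mem_range.1 hi; omega)) (ha0 i (mem_range.1 hi))
          _ = (∑ i ∈ range I, a i) * B := by rw [Finset.sum_mul]
          _ ≤ B := mul_le_of_le_one_left (hUI.trans (hB I (by omega))) hasum
      have h2 : M / (M - 1) = 1 + 1 / (M - 1) := by
        have : M - 1 ≠ 0 := by linarith
        field_simp
        ring
      rw [h2, add_mul, one_mul, one_div_mul_eq_div]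
      have h3 : 0 < M - 1 := by linarith
      gcongr
    have htail : ∑ s ∈ Ico (grid L h w I) T, R w s * w s ≤ L + 1 - p I := by
      have h1 : ∑ s ∈ Ico (grid L h w I) T, R w s * w s ≤ ∑ s ∈ Ico (grid L h w I) T, w s :=
        Finset.sum_le_sum fun s hs => mul_le_of_le_one_left (hw.nonneg hlo.le s)
          (hS.alloc_mem w hwval s (mem_Ico.1 hs).2).2
      have h2 := Finset.sum_range_add_sum_Ico w hgIT
      rw [hw.sum_range_eq (hw.length_le hlo hT)] at h2
      have h3 := hw.total_le
      have h4 : p I = ∑ s ∈ range (grid L h w I), w s := rfl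
      linarith
    have hsplit := Finset.sum_range_add_sum_Ico (fun s => R w s * w s) hgIT
    have hdU : 0 ≤ d * U (v I) := mul_nonneg (by linarith) hUI
    rw [hexp, stepLoss, ← hsplit]
    rw [hc_def] at hJ1
    have : 2 * L / M = 2 * (L / M) := by ring
    linarith

/-- `w` is a valuation over `T` rounds of total value in `[L, L + 1]`. -/
def HasTotalNear (T : ℕ) (L : ℝ) (w : ℕ → ℝ) : Prop :=
  IsValuation T w ∧ L ≤ ∑ t ∈ range T, w t ∧ ∑ t ∈ range T, w t ≤ L + 1

lemma IsRamp.hasTotalNear {L lo hi : ℝ} {n T : ℕ} {w : ℕ → ℝ} (hw : IsRamp L lo hi n w)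
    (hlo : 0 < lo) (hlh : lo ≤ hi) (hhi : hi ≤ 1) (hT : L + 1 ≤ lo * T) : HasTotalNear T L w := by
  have hs := hw.sum_range_eq (hw.length_le hlo hT)
  exact ⟨hw.isValuation hlo.le (hlo.le.trans hlh) hhi T, hs ▸ hw.le_total, hs ▸ hw.total_le⟩

lemma exists_isRamp {L lo : ℝ} (hL : 0 < L) (hlo : 0 < lo) (hlo1 : lo ≤ 1) :
    ∃ n w, IsRamp L lo lo n w := by
  refine ⟨⌈L / lo⌉₊, fun s => if s < ⌈L / lo⌉₊ then lo else 0, ?_⟩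
  have hsum : ∑ s ∈ range ⌈L / lo⌉₊, (if s < ⌈L / lo⌉₊ then lo else 0) = ⌈L / lo⌉₊ * lo := by
    rw [Finset.sum_congr rfl (g := fun _ => lo)]
    · simp
    · intro s hs
      simp [mem_range.1 hs]
  refine ⟨?_, ?_, ?_, ?_, ?_, ?_⟩
  · intro s t hst ht
    simp [ht, hst.trans_lt ht]
  · intro t ht
    simp [ht]
  · intro t ht
    simp [ht]
  · intro t ht
    simp [not_lt.2 ht]
  · rw [hsum]
    exact (div_le_iff₀ hlo).1 (Nat.le_ceil _)
  · rw [hsum]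
    have := mul_lt_mul_of_pos_right (Nat.ceil_lt_add_one (div_pos hL hlo).le) hlo
    rw [add_mul, div_mul_cancel₀ _ hlo.ne'] at this
    linarith

/-- The revenue that a screening mechanism with allocation `R` and utility `U` earns from `w`. -/
def screeningRev (T : ℕ) (R : (ℕ → ℝ) → ℕ → ℝ) (U : (ℕ → ℝ) → ℝ) (w : ℕ → ℝ) : ℝ :=
  ∑ t ∈ range T, R w t * w t - U w

lemma exists_ladder {L lo M B : ℝ} {T : ℕ} (hL : 0 < L) (hlo : 0 < lo) (hM : 1 < M)
    (hT : L + 1 ≤ lo * T) (j : ℕ) (hj : M ^ j * lo ≤ 1) :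
    ∃ (κ : Type) (_ : Fintype κ) (c : κ → ℝ) (u : κ → ℕ → ℝ) (ι : Type) (_ : Fintype ι)
      (q : ι → ℝ) (v : ι → ℕ → ℝ),
      (∀ a, 0 ≤ c a) ∧ ∑ a, c a = j ∧ (∀ a, HasTotalNear T L (u a)) ∧
      (∀ i, 0 ≤ q i) ∧ ∑ i, q i = 1 ∧ (∀ i, ∃ n, IsRamp L lo (M ^ j * lo) n (v i)) ∧
      ∀ R U, IsScreening T L B R U →
        ∑ a, c a * screeningRev T R U (u a) ≤
          j * (L / Real.exp 1 + stepLoss L M B) + ∑ i, q i * U (v i) := by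
  induction j with
  | zero =>
    obtain ⟨n, w, hw⟩ := exists_isRamp hL hlo (by simpa using hj)
    refine ⟨Empty, inferInstance, Empty.elim, Empty.elim, Unit, inferInstance, fun _ => 1,
      fun _ => w, by simp, by simp, fun a => a.elim, by simp, by simp,
      fun _ => ⟨n, by simpa using hw⟩, ?_⟩
    intro R U hS
    simpa using hS.utility_nonneg w (hw.isValuation hlo.le hlo.le (by simpa using hj) T)
  | succ j ih =>
    have hMj : 1 ≤ M ^ j := one_le_pow₀ hM.le
    have hlh : lo ≤ M ^ j * lo := le_mul_of_one_le_left hlo.le hMj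
    have hMhi : M * (M ^ j * lo) ≤ 1 := by rwa [← mul_assoc, ← pow_succ']
    have hhi1 : M ^ j * lo ≤ 1 := by nlinarith
    obtain ⟨κ, _, c, u, ι, _, q, v, hc, hcsum, hu, hq, hqsum, hv, hrev⟩ := ih hhi1
    choose n hn using hv
    choose m p y hp hpsum hy hstep using fun i =>
      (hn i).exists_randomized_jump (B := B) hL hlo hlh hM hMhi hT
    refine ⟨κ ⊕ ι, inferInstance, Sum.elim c q, Sum.elim u v, Σ i, Fin (m i), inferInstance,
      fun s => q s.1 * p s.1 s.2, fun s => y s.1 s.2, ?_, ?_, ?_, ?_, ?_, ?_, ?_⟩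
    · rintro (a | i)
      · exact hc a
      · exact hq i
    · simp [hcsum, hqsum]
    · rintro (a | i)
      · exact hu a
      · exact (hn i).hasTotalNear hlo hlh hhi1 hT
    · exact fun s => mul_nonneg (hq _) (hp _ _ s.2.2)
    · rw [Fintype.sum_sigma, ← hqsum]
      refine Finset.sum_congr rfl fun i _ => ?_
      dsimp only
      rw [← Finset.mul_sum, ← Finset.sum_range (fun k => p i k), hpsum, mul_one]
    · intro s
      obtain ⟨n', hn'⟩ := hy s.1 s.2 s.2.2
      exact ⟨n', by rwa [pow_succ', mul_assoc]⟩
    · intro R U hS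
      rw [Fintype.sum_sum_type, Fintype.sum_sigma]
      simp only [Sum.elim_inl, Sum.elim_inr]
      have h1 : ∑ i, q i * screeningRev T R U (v i) ≤
          ∑ i, q i * (∑ k ∈ range (m i), p i k * U (y i k) - U (v i) +
            (L / Real.exp 1 + stepLoss L M B)) :=
        Finset.sum_le_sum fun i _ => mul_le_mul_of_nonneg_left (hstep i R U hS) (hq i)
      have h2 : ∑ i, ∑ k : Fin (m i), q i * p i k * U (y i k) =
          ∑ i, q i * ∑ k ∈ range (m i), p i k * U (y i k) := by
        refine Finset.sum_congr rfl fun i _ => ?_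
        rw [Finset.sum_range, Finset.mul_sum]
        exact Finset.sum_congr rfl fun k _ => mul_assoc _ _ _
      simp only [mul_add, mul_sub, Finset.sum_add_distrib, Finset.sum_sub_distrib] at h1
      rw [← Finset.sum_mul, ← Finset.sum_mul, hqsum] at h1
      rw [h2]
      push_cast
      linarith [hrev R U hS]

/-- A finite family of types, weighted with total weight `K`, from which no screening mechanism
earns much more than `L / e` per unit of weight. -/
lemma exists_hard_types {L M B : ℝ} {K T : ℕ} (hL : 0 < L) (hM : 1 < M)
    (hT : (L + 1) * M ^ K ≤ T) :
    ∃ (κ : Type) (_ : Fintype κ) (c : κ → ℝ) (u : κ → ℕ → ℝ),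
      (∀ a, 0 ≤ c a) ∧ ∑ a, c a = K ∧ (∀ a, HasTotalNear T L (u a)) ∧
      ∀ R U, IsScreening T L B R U →
        ∑ a, c a * screeningRev T R U (u a) ≤ K * (L / Real.exp 1 + stepLoss L M B) + B := by
  have hMK : 0 < M ^ K := by positivity
  have hT' : L + 1 ≤ (M ^ K)⁻¹ * T := by
    rw [inv_mul_eq_div, le_div_iff₀ hMK]
    exact hT
  have hK1 : M ^ K * (M ^ K)⁻¹ = 1 := mul_inv_cancel₀ hMK.ne'
  obtain ⟨κ, _, c, u, ι, _, q, v, hc, hcsum, hu, hq, hqsum, hv, hrev⟩ :=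
    exists_ladder (B := B) hL (inv_pos.2 hMK) hM hT' K hK1.le
  refine ⟨κ, inferInstance, c, u, hc, hcsum, hu, fun R U hS => (hrev R U hS).trans ?_⟩
  have : ∑ i, q i * U (v i) ≤ ∑ i, q i * B := by
    refine Finset.sum_le_sum fun i _ => mul_le_mul_of_nonneg_left ?_ (hq i)
    obtain ⟨n, hn⟩ := hv i
    have hnear := hn.hasTotalNear (inv_pos.2 hMK)
      (hK1.symm ▸ inv_le_one_of_one_le₀ (one_le_pow₀ hM.le)) hK1.le hT'
    exact hS.utility_le _ hnear.1 hnear.2.1 hnear.2.2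
  rw [← Finset.sum_mul, hqsum, one_mul] at this
  linarith

lemma sum_Icc_one_eq_sum_range (f : ℕ → ℝ) (T : ℕ) :
    ∑ t ∈ Icc 1 T, f t = ∑ t ∈ range T, f (t + 1) := by
  induction T with
  | zero => simp
  | succ T ih => rw [Finset.sum_Icc_succ_top (by omega), ih, Finset.sum_range_succ]

/-- The profile in which bidder `i` has type `a`, bidder `j` has type `b` (with rounds reindexed
to start at `1`), and all other bidders have value zero. -/
def pairProfile {k : ℕ} (i j : Fin k) (a b : ℕ → ℝ) : Fin k → ℕ → ℝ :=
  Function.update (Function.update 0 j fun t => b (t - 1)) i fun t => a (t - 1)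

/-- The utility of bidder `i` under truthful reporting. -/
def bidderUtility {k : ℕ} (T : ℕ) (r x : (Fin k → ℕ → ℝ) → Fin k → ℕ → ℝ)
    (g : (Fin k → ℕ → ℝ) → Fin k → ℝ) (v : Fin k → ℕ → ℝ) (i : Fin k) : ℝ :=
  (∑ t ∈ Icc 1 T, (r v i t * v i t - x v i t)) + g v i

section PairProfile

variable {k : ℕ} {i j : Fin k} {a b : ℕ → ℝ}

lemma pairProfile_left : pairProfile i j a b i = fun t => a (t - 1) := by
  simp [pairProfile]

lemma pairProfile_comm (hij : i ≠ j) : pairProfile i j a b = pairProfile j i b a :=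
  Function.update_comm hij.symm _ _ _

lemma pairProfile_right (hij : i ≠ j) : pairProfile i j a b j = fun t => b (t - 1) := by
  rw [pairProfile_comm hij, pairProfile_left]

lemma pairProfile_of_ne {l : Fin k} (hi : l ≠ i) (hj : l ≠ j) : pairProfile i j a b l = 0 := by
  simp [pairProfile, hi, hj]

lemma update_pairProfile (a' : ℕ → ℝ) :
    Function.update (pairProfile i j a b) i (fun t => a' (t - 1)) = pairProfile i j a' b := by
  simp [pairProfile]

lemma isProfileK_pairProfile {T : ℕ} (hij : i ≠ j) (ha : IsValuation T a)
    (hb : IsValuation T b) : IsProfileK k T (pairProfile i j a b) := by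
  intro l t ht
  have ht' := mem_Icc.1 ht
  by_cases hi : l = i
  · rw [hi, pairProfile_left]
    exact ha (t - 1) (by omega)
  · by_cases hj : l = j
    · rw [hj, pairProfile_right hij]
      exact hb (t - 1) (by omega)
    · simp [pairProfile_of_ne hi hj]

lemma le_revSTBK_pairProfile {T : ℕ} {L : ℝ} (hij : i ≠ j) (ha : L ≤ ∑ t ∈ range T, a t)
    (hb : L ≤ ∑ t ∈ range T, b t) : L ≤ RevSTBK k T (pairProfile i j a b) := by
  have hmin : L ≤ min (TotVal T (pairProfile i j a b) i) (TotVal T (pairProfile i j a b) j) := by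
    rw [TotVal, TotVal, pairProfile_left, pairProfile_right hij, sum_Icc_one_eq_sum_range,
      sum_Icc_one_eq_sum_range]
    simpa using ⟨ha, hb⟩
  refine hmin.trans (le_csSup ?_ ⟨i, j, hij, rfl⟩)
  refine ((Set.finite_range fun y : Fin k × Fin k => min (TotVal T (pairProfile i j a b) y.1)
    (TotVal T (pairProfile i j a b) y.2)).subset ?_).bddAbove
  rintro _ ⟨i', j', -, rfl⟩
  exact ⟨(i', j'), rfl⟩

variable {T : ℕ} {r x : (Fin k → ℕ → ℝ) → Fin k → ℕ → ℝ} {g : (Fin k → ℕ → ℝ) → Fin k → ℝ}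

lemma TruthfulK.revK_pairProfile_le (hT : TruthfulK k T r x g) (hij : i ≠ j)
    (ha : IsValuation T a) (hb : IsValuation T b) :
    RevK k T x g (pairProfile i j a b) ≤
      screeningRev T (fun a t => r (pairProfile i j a b) i (t + 1))
        (fun a => bidderUtility T r x g (pairProfile i j a b) i) a +
      screeningRev T (fun b t => r (pairProfile j i b a) j (t + 1))
        (fun b => bidderUtility T r x g (pairProfile j i b a) j) b := by
  have hv := isProfileK_pairProfile hij ha hb
  simp only [screeningRev, bidderUtility, ← pairProfile_comm hij]
  set v := pairProfile i j a b with hvdef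
  have hi : ∑ t ∈ range T, r v i (t + 1) * a t = ∑ t ∈ Icc 1 T, r v i t * v i t := by
    rw [sum_Icc_one_eq_sum_range, hvdef, pairProfile_left]
    simp
  have hj : ∑ t ∈ range T, r v j (t + 1) * b t = ∑ t ∈ Icc 1 T, r v j t * v j t := by
    rw [sum_Icc_one_eq_sum_range, hvdef, pairProfile_right hij]
    simp
  rw [hi, hj, Finset.sum_sub_distrib, Finset.sum_sub_distrib, RevK, ← Finset.sum_sub_distrib]
  have hothers : ∑ l ∈ {i, j}, -(∑ t ∈ Icc 1 T, x v l t - g v l) ≤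
      ∑ l, -(∑ t ∈ Icc 1 T, x v l t - g v l) := by
    refine Finset.sum_le_sum_of_subset_of_nonneg (Finset.subset_univ _) fun l _ hl => ?_
    simp only [Finset.mem_insert, Finset.mem_singleton, not_or] at hl
    have hx : ∑ t ∈ Icc 1 T, x v l t ≤ 0 := by
      refine Finset.sum_nonpos fun t ht => ?_
      have := (((hT.1 v hv).2 t ht).1 l).2.2
      rwa [show v l = 0 from pairProfile_of_ne hl.1 hl.2, Pi.zero_apply, mul_zero] at this
    linarith [(hT.1 v hv).1 l]
  rw [Finset.sum_pair hij, Finset.sum_neg_distrib] at hothers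
  linarith

lemma TruthfulK.incentive_pairProfile (hT : TruthfulK k T r x g) (hij : i ≠ j) {a' : ℕ → ℝ}
    (ha : IsValuation T a) (ha' : IsValuation T a') (hb : IsValuation T b) {τ : ℕ} (hτ : 1 ≤ τ)
    (hτT : τ ≤ T) (hle : ∀ t < τ, a' t ≤ a t) :
    ∑ t ∈ range τ, r (pairProfile i j a' b) i (t + 1) * (a t - a' t) ≤
      bidderUtility T r x g (pairProfile i j a b) i := by
  have hv := isProfileK_pairProfile hij ha hb
  have hv' := isProfileK_pairProfile hij ha' hb
  have hmem : ∀ t ∈ Icc 1 τ, t ∈ Icc 1 T := fun t ht =>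
    mem_Icc.2 ⟨(mem_Icc.1 ht).1, (mem_Icc.1 ht).2.trans hτT⟩
  have hfeas := (hT.1 _ hv').2
  have hpay : ∀ t ∈ Icc 1 τ, x (pairProfile i j a' b) i t ≤
      r (pairProfile i j a' b) i t * a' (t - 1) := fun t ht => by
    have := ((hfeas t (hmem t ht)).1 i).2.2
    rwa [pairProfile_left] at this
  have hic := hT.2 _ hv i (fun t => a' (t - 1)) (by rwa [update_pairProfile]) τ
    (mem_Icc.2 ⟨hτ, hτT⟩)
  rw [update_pairProfile] at hic
  refine le_trans ?_ (hic fun t ht => ?_)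
  · have hx := ((hfeas τ (mem_Icc.2 ⟨hτ, hτT⟩)).1 i).2.1
    refine le_add_of_le_of_nonneg ?_ hx
    have hsum : ∑ t ∈ range τ, r (pairProfile i j a' b) i (t + 1) * (a t - a' t) =
        ∑ t ∈ Icc 1 τ, r (pairProfile i j a' b) i t * (a (t - 1) - a' (t - 1)) := by
      simp [sum_Icc_one_eq_sum_range]
    rw [← sub_nonneg, pairProfile_left, hsum, ← Finset.sum_sub_distrib]
    refine Finset.sum_nonneg fun t ht => ?_
    linarith [hpay t ht]
  · refine (hpay t ht).trans ?_
    rw [pairProfile_left]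
    have ht' := mem_Icc.1 ht
    exact mul_le_mul_of_nonneg_left (hle (t - 1) (by omega)) ((hfeas t (hmem t ht)).1 i).1.1

lemma TruthfulK.bidderUtility_nonneg (hT : TruthfulK k T r x g) (hT1 : 1 ≤ T) (hij : i ≠ j)
    (ha : IsValuation T a) (hb : IsValuation T b) :
    0 ≤ bidderUtility T r x g (pairProfile i j a b) i := by
  simpa using hT.incentive_pairProfile hij ha ha hb le_rfl hT1 fun _ _ => le_rfl

lemma TruthfulK.alloc_mem_pairProfile (hT : TruthfulK k T r x g) (hij : i ≠ j)
    (ha : IsValuation T a) (hb : IsValuation T b) {t : ℕ} (ht : t < T) :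
    r (pairProfile i j a b) i (t + 1) ∈ Set.Icc (0 : ℝ) 1 :=
  (((hT.1 _ (isProfileK_pairProfile hij ha hb)).2 (t + 1)
    (mem_Icc.2 ⟨by omega, by omega⟩)).1 i).1

lemma TruthfulK.isScreening (hT : TruthfulK k T r x g) (hT1 : 1 ≤ T) (hij : i ≠ j)
    {L α β : ℝ} (hL : 0 ≤ L) (hα : 0 ≤ α)
    (hrev : ∀ v, IsProfileK k T v → RevK k T x g v ≥ α * RevSTBK k T v - β)
    (hb : HasTotalNear T L b) :
    IsScreening T L (2 * L + 2 + β) (fun a t => r (pairProfile i j a b) i (t + 1))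
      (fun a => bidderUtility T r x g (pairProfile i j a b) i) where
  alloc_mem a ha t ht := hT.alloc_mem_pairProfile hij ha hb.1 ht
  utility_nonneg a ha := hT.bidderUtility_nonneg hT1 hij ha hb.1
  utility_le a ha hL1 hL2 := by
    have h1 := hT.revK_pairProfile_le hij ha hb.1
    have h2 := hrev _ (isProfileK_pairProfile hij ha hb.1)
    have h3 := hL.trans (le_revSTBK_pairProfile hij hL1 hb.2.1)
    have h4 := hT.bidderUtility_nonneg hT1 hij.symm hb.1 ha
    have h5 : ∑ t ∈ range T, r (pairProfile i j a b) i (t + 1) * a t ≤ ∑ t ∈ range T, a t :=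
      Finset.sum_le_sum fun t ht => mul_le_of_le_one_left (ha t (mem_range.1 ht)).1
        (hT.alloc_mem_pairProfile hij ha hb.1 (mem_range.1 ht)).2
    have h6 : ∑ t ∈ range T, r (pairProfile j i b a) j (t + 1) * b t ≤ ∑ t ∈ range T, b t :=
      Finset.sum_le_sum fun t ht => mul_le_of_le_one_left (hb.1 t (mem_range.1 ht)).1
        (hT.alloc_mem_pairProfile hij.symm hb.1 ha (mem_range.1 ht)).2
    simp only [screeningRev] at h1
    linarith [hb.2.2, mul_nonneg hα h3]
  incentive v w hv hw τ hτ hle := by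
    rcases Nat.eq_zero_or_pos τ with rfl | h
    · simpa using hT.bidderUtility_nonneg hT1 hij hv hb.1
    · exact hT.incentive_pairProfile hij hv hw hb.1 h hτ hle

end PairProfile

/-- Against the hard types, drawn independently for two bidders, a truthful mechanism earns at
most twice the single-bidder bound. -/
lemma TruthfulK.guarantee_le {k T K : ℕ} (hk : 2 ≤ k) {L M α β : ℝ} (hL : 0 < L) (hM : 1 < M)
    (hα : 0 ≤ α) (hK : 0 < K) (hLT : (L + 1) * M ^ K ≤ T)
    {r x : (Fin k → ℕ → ℝ) → Fin k → ℕ → ℝ} {g : (Fin k → ℕ → ℝ) → Fin k → ℝ}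
    (hT : TruthfulK k T r x g)
    (hrev : ∀ v, IsProfileK k T v → RevK k T x g v ≥ α * RevSTBK k T v - β) :
    K * (α * L - β) ≤
      2 * (K * (L / Real.exp 1 + stepLoss L M (2 * L + 2 + β)) + (2 * L + 2 + β)) := by
  have hT1 : 1 ≤ T := by
    have : (0 : ℝ) < T := lt_of_lt_of_le (by positivity) hLT
    exact_mod_cast this
  obtain ⟨κ, _, c, u, hc, hcsum, hu, hS⟩ :=
    exists_hard_types (B := 2 * L + 2 + β) hL hM hLT
  set D := K * (L / Real.exp 1 + stepLoss L M (2 * L + 2 + β)) + (2 * L + 2 + β)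
  set i : Fin k := ⟨0, by omega⟩
  set j : Fin k := ⟨1, by omega⟩
  have hij : i ≠ j := by simp [i, j]
  -- the revenue from bidder `l` of type `a` when bidder `m` has type `b`
  set ρ : Fin k → Fin k → (ℕ → ℝ) → (ℕ → ℝ) → ℝ := fun l m a b =>
    screeningRev T (fun a t => r (pairProfile l m a b) l (t + 1))
      (fun a => bidderUtility T r x g (pairProfile l m a b) l) a
  have hbound : ∀ l m, l ≠ m → ∀ e, ∑ d, c d * ρ l m (u d) (u e) ≤ D := fun l m hlm e =>
    hS _ _ (hT.isScreening hT1 hlm hL.le hα hrev (hu e))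
  have htotal : ∀ l m, l ≠ m → ∑ e, c e * ∑ d, c d * ρ l m (u d) (u e) ≤ K * D := by
    intro l m hlm
    rw [← hcsum, Finset.sum_mul]
    exact Finset.sum_le_sum fun e _ => mul_le_mul_of_nonneg_left (hbound l m hlm e) (hc e)
  have hpair : ∀ d e, α * L - β ≤ ρ i j (u d) (u e) + ρ j i (u e) (u d) := by
    intro d e
    have h1 := hT.revK_pairProfile_le hij (hu d).1 (hu e).1
    have h2 := hrev _ (isProfileK_pairProfile hij (hu d).1 (hu e).1)
    have h3 := le_revSTBK_pairProfile hij (hu d).2.1 (hu e).2.1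
    have h4 := mul_le_mul_of_nonneg_left h3 hα
    exact le_trans (by linarith) h1
  have hlower : (K : ℝ) * (K * (α * L - β)) ≤
      ∑ e, c e * ∑ d, c d * (ρ i j (u d) (u e) + ρ j i (u e) (u d)) := by
    rw [← hcsum, Finset.sum_mul]
    refine Finset.sum_le_sum fun e _ => mul_le_mul_of_nonneg_left ?_ (hc e)
    rw [Finset.sum_mul]
    exact Finset.sum_le_sum fun d _ => mul_le_mul_of_nonneg_left (hpair d e) (hc d)
  have hswap : ∑ e, c e * ∑ d, c d * ρ j i (u e) (u d) =
      ∑ d, c d * ∑ e, c e * ρ j i (u e) (u d) := by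
    simp only [Finset.mul_sum]
    rw [Finset.sum_comm]
    exact Finset.sum_congr rfl fun _ _ => Finset.sum_congr rfl fun _ _ => by ring
  simp only [mul_add, Finset.sum_add_distrib] at hlower
  rw [hswap] at hlower
  have hKpos : (0 : ℝ) < K := by exact_mod_cast hK
  refine le_of_mul_le_mul_left ?_ hKpos
  linarith [htotal i j hij, htotal j i hij.symm]

/-- For any `k ≥ 2`, `α > 2/e` and `β ≥ 0`, for all sufficiently large `T` there
is no truthful `k`-bidder mechanism over `T` rounds with revenue at least
`α · RevSTB(v) − β` on every type profile `v`. -/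
theorem stmt15 (k : ℕ) (hk : 2 ≤ k) (α β : ℝ) (hα : α > 2 / Real.exp 1) (hβ : 0 ≤ β) :
    ∃ T₀ : ℕ, ∀ T : ℕ, T₀ ≤ T →
      ¬ ∃ (r x : (Fin k → ℕ → ℝ) → Fin k → ℕ → ℝ)
          (g : (Fin k → ℕ → ℝ) → Fin k → ℝ), TruthfulK k T r x g ∧
        ∀ v, IsProfileK k T v → RevK k T x g v ≥ α * RevSTBK k T v - β := by
  have he : 0 < 2 / Real.exp 1 := by positivity
  set δ := α - 2 / Real.exp 1 with hδ_def
  have hδ : 0 < δ := sub_pos.2 hα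
  obtain ⟨K, hK⟩ := exists_nat_gt (24 / δ)
  have hK0 : 0 < K := by
    have : (0 : ℝ) < K := lt_trans (by positivity) hK
    exact_mod_cast this
  have hK1 : (1 : ℝ) ≤ K := by exact_mod_cast hK0
  set L := 2 * (14 + 5 * β) / δ + 1 with hL_def
  have hL : 0 < L := by positivity
  refine ⟨⌈(L + 1) * ((K : ℝ) + 1) ^ K⌉₊, fun T hT => ?_⟩
  rintro ⟨r, x, g, htruth, hrev⟩
  have h := htruth.guarantee_le hk hL (M := (K : ℝ) + 1) (by linarith) (he.trans hα).le hK0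
    (Nat.ceil_le.1 hT) hrev
  have h1 : (K : ℝ) * stepLoss L (K + 1) (2 * L + 2 + β) ≤ 3 * K + 4 * L + 2 + β := by
    have h2 : (K : ℝ) * stepLoss L (K + 1) (2 * L + 2 + β) =
        3 * K + 2 * L * (K / (K + 1)) + (2 * L + 2 + β) := by
      rw [stepLoss, add_sub_cancel_right]
      field_simp
    have h3 : (K : ℝ) / (K + 1) ≤ 1 := (div_le_one (by linarith)).2 (by linarith)
    nlinarith
  have h4 : 24 < K * δ := (div_lt_iff₀ hδ).1 hK
  have h5 : δ * L = 2 * (14 + 5 * β) + δ := by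
    rw [hL_def]
    field_simp
  have h6 : K * (δ * L) ≤ K * β + 6 * K + 12 * L + 8 + 4 * β := by
    have h7 : K * (δ * L) = K * (α * L) - 2 * (K * (L / Real.exp 1)) := by
      rw [hδ_def]
      ring
    linarith
  have h8 : 24 * L ≤ K * (δ * L) := by nlinarith
  nlinarith [mul_nonneg (sub_nonneg.2 hK1) hβ, mul_pos (lt_of_lt_of_le one_pos hK1) hδ]
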